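/- arXiv:1110.2507 — 2 statements merged into one kernel-verified Lean document; each statement's English description precedes it below -/
import Mathlib

section
/- For every n ≥ 1, the unique satisfying spin assignment σ on the stack triangulation Δ_n with σ(x) = σ(y_n) = +1 is given by σ(x) = +1, σ(z) = −1, and σ(y_i) = (−1)^{n−i} for all 0 ≤ i ≤ n. -/
/-- A spin assignment: each vertex gets spin `+1` or `-1`. -/
def IsSpin {V : Type*} (σ : V → ℤ) : Prop := ∀ v, σ v = 1 ∨ σ v = -1

/-- A face is monochromatic under `σ` when `σ` is constant on it. -/
def FaceMono {V : Type*} (σ : V → ℤ) (f : Finset V) : Prop :=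
  ∀ u ∈ f, ∀ v ∈ f, σ u = σ v

/-- A satisfying spin assignment: a spin assignment under which no face is monochromatic. -/
def Satisfying {V : Type*} (F : Finset (Finset V)) (σ : V → ℤ) : Prop :=
  IsSpin σ ∧ ∀ f ∈ F, ¬ FaceMono σ f

/-- Vertices of the stack triangulation `Δ_n`: `Sum.inl i` is `y_i` (for `0 ≤ i ≤ n`),
`Sum.inr false` is `x` and `Sum.inr true` is `z`. -/
abbrev StackV (n : ℕ) := Fin (n + 1) ⊕ Bool

/-- The vertex `x` of `Δ_n`. -/
def vx {n : ℕ} : StackV n := Sum.inr false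

/-- The vertex `z` of `Δ_n`. -/
def vz {n : ℕ} : StackV n := Sum.inr true

/-- The vertex `y_i` of `Δ_n`. -/
def vy {n : ℕ} (i : Fin (n + 1)) : StackV n := Sum.inl i

/-- The faces of the stack triangulation `Δ_n`: `{x, y₀, z}`, `{x, y_n, z}` and, for each
`1 ≤ i ≤ n`, the faces `{x, y_{i-1}, y_i}` and `{z, y_{i-1}, y_i}`. -/
def StackFaces (n : ℕ) : Finset (Finset (StackV n)) :=
  ({{vx, vy 0, vz}, {vx, vy (Fin.last n), vz}} : Finset (Finset (StackV n))) ∪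
    Finset.image (fun i : Fin n => {vx, vy i.castSucc, vy i.succ}) Finset.univ ∪
    Finset.image (fun i : Fin n => {vz, vy i.castSucc, vy i.succ}) Finset.univ

theorem faceMono_triple_iff {V : Type*} [DecidableEq V] (σ : V → ℤ) (a b c : V) :
    FaceMono σ {a, b, c} ↔ σ a = σ b ∧ σ b = σ c := by
  simp only [FaceMono, Finset.mem_insert, Finset.mem_singleton, forall_eq_or_imp, forall_eq]
  grind

theorem satisfying_stackFaces_iff {n : ℕ} (σ : StackV n → ℤ) :
    Satisfying (StackFaces n) σ ↔ IsSpin σ ∧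
      ¬ (σ vx = σ (vy 0) ∧ σ (vy 0) = σ vz) ∧
      ¬ (σ vx = σ (vy (Fin.last n)) ∧ σ (vy (Fin.last n)) = σ vz) ∧
      ∀ i : Fin n, ¬ (σ vx = σ (vy i.castSucc) ∧ σ (vy i.castSucc) = σ (vy i.succ)) ∧
        ¬ (σ vz = σ (vy i.castSucc) ∧ σ (vy i.castSucc) = σ (vy i.succ)) := by
  simp only [Satisfying, StackFaces, Finset.mem_union, Finset.mem_insert, Finset.mem_singleton,
    Finset.mem_image, Finset.mem_univ, true_and, or_imp, forall_and, forall_eq,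
    forall_exists_index, forall_apply_eq_imp_iff, faceMono_triple_iff, and_assoc]

/-- For every `n ≥ 1`, the unique satisfying spin assignment `σ` on the stack triangulation
`Δ_n` with `σ(x) = σ(y_n) = +1` is given by `σ(x) = 1`, `σ(z) = -1` and
`σ(y_i) = (-1)^(n - i)` for all `0 ≤ i ≤ n`. -/
theorem stack_unique_satisfying_explicit (n : ℕ) (hn : 1 ≤ n) (σ : StackV n → ℤ) :
    (Satisfying (StackFaces n) σ ∧ σ vx = 1 ∧ σ (vy (Fin.last n)) = 1) ↔
      σ = fun v => match v with
        | Sum.inr false => 1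
        | Sum.inr true => -1
        | Sum.inl i => (-1 : ℤ) ^ (n - (i : ℕ)) := by
  rw [satisfying_stackFaces_iff]
  constructor
  · rintro ⟨⟨hs, -, hl, hf⟩, hx, hy⟩
    have hz : σ vz = -1 := by
      have := hs vz
      grind
    have hstep (i : Fin n) : σ (vy i.castSucc) = -σ (vy i.succ) := by
      have := hs (vy i.castSucc)
      have := hs (vy i.succ)
      have := hf i
      grind
    have hpow (i : Fin (n + 1)) : σ (vy i) = (-1 : ℤ) ^ (n - (i : ℕ)) := by
      induction i using Fin.reverseInduction with
      | last => simpa using hy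
      | cast i ih =>
        have hi : n - (i.castSucc : ℕ) = n - (i.succ : ℕ) + 1 := by
          simp only [Fin.val_castSucc, Fin.val_succ]
          omega
        rw [hstep, ih, hi, pow_succ, mul_neg_one]
    funext v
    rcases v with i | _ | _
    exacts [hpow i, hx, hz]
  · rintro rfl
    refine ⟨⟨?_, ?_, ?_, fun i => ?_⟩, rfl, by simp [vy]⟩
    · rintro (i | _ | _)
      exacts [neg_one_pow_eq_or ℤ _, Or.inl rfl, Or.inr rfl]
    · simp only [vx, vy, vz]
      grind
    · simp only [vx, vy, vz]
      grind
    · have hi : n - (i : ℕ) = n - (i + 1 : ℕ) + 1 := by omega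
      have := neg_one_pow_eq_or ℤ (n - (i + 1 : ℕ))
      simp only [vx, vy, vz, Fin.val_castSucc, Fin.val_succ]
      rw [hi, pow_succ]
      grind
end

section
/- Let G = (V,E) be a finite simple graph and F a family of 3-element subsets of V, each spanning a triangle of G, such that every edge of G lies in exactly two members of F. If there exists at least one satisfying spin assignment on (G,F), then every groundstate (every minimizer of the antiferromagnetic Hamiltonian H) is a satisfying spin assignment, i.e., under every minimizer each face of F has exactly one monochromatic edge. -/
open scoped Classical

/-- An edge is monochromatic (frustrated) under `σ` when both of its ends get the same spin. -/
def EdgeMono {V : Type*} (σ : V → ℤ) (e : Sym2 V) : Prop :=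
  ∀ u ∈ e, ∀ v ∈ e, σ u = σ v

/-- The antiferromagnetic Hamiltonian `H(σ) = Σ_{{u,v} ∈ E} σ(u) σ(v)`. -/
def Hamiltonian {V : Type*} (E : Finset (Sym2 V)) (σ : V → ℤ) : ℤ :=
  ∑ e ∈ E, Sym2.lift ⟨fun u v => σ u * σ v, fun u v => mul_comm _ _⟩ e

/-- The interaction `σ u * σ v` of an edge `s(u, v)`. -/
def edgeEnergy {V : Type*} (σ : V → ℤ) (e : Sym2 V) : ℤ :=
  Sym2.lift ⟨fun u v => σ u * σ v, fun _ _ => mul_comm _ _⟩ e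

lemma edgeEnergy_mk {V : Type*} (σ : V → ℤ) (u v : V) : edgeEnergy σ s(u, v) = σ u * σ v := rfl

/-- The energy of the edges contained in a face. -/
noncomputable def faceEnergy {V : Type*} (E : Finset (Sym2 V)) (σ : V → ℤ) (f : Finset V) : ℤ :=
  ∑ e ∈ E with ∀ v ∈ e, v ∈ f, edgeEnergy σ e

lemma sum_faceEnergy {V : Type*} (E : Finset (Sym2 V)) (F : Finset (Finset V))
    (htwo : ∀ e ∈ E, (F.filter (fun f => ∀ v ∈ e, v ∈ f)).card = 2) (σ : V → ℤ) :
    ∑ f ∈ F, faceEnergy E σ f = 2 * Hamiltonian E σ := by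
  simp only [faceEnergy, Finset.sum_filter]
  rw [Finset.sum_comm, Hamiltonian, Finset.mul_sum]
  refine Finset.sum_congr rfl fun e he => ?_
  rw [← Finset.sum_filter, Finset.sum_const, htwo e he, nsmul_eq_mul]
  rfl

lemma faceEnergy_triangle {V : Type*} {E : Finset (Sym2 V)}
    (hsimple : ∀ e ∈ E, ¬ e.IsDiag) (σ : V → ℤ) {a b c : V}
    (hab : a ≠ b) (hac : a ≠ c) (hbc : b ≠ c)
    (eab : s(a, b) ∈ E) (eac : s(a, c) ∈ E) (ebc : s(b, c) ∈ E) :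
    faceEnergy E σ {a, b, c} = σ a * σ b + σ a * σ c + σ b * σ c := by
  have hE : (E.filter fun e => ∀ v ∈ e, v ∈ ({a, b, c} : Finset V)) =
      {s(a, b), s(a, c), s(b, c)} := by
    ext e
    induction e with
    | _ x y =>
      simp only [Finset.mem_filter, Finset.mem_insert, Finset.mem_singleton, Sym2.mem_iff,
        forall_eq_or_imp, forall_eq]
      constructor
      · rintro ⟨he, hx, hy⟩
        have hxy : x ≠ y := fun h => hsimple _ he (Sym2.mk_isDiag_iff.2 h)
        rcases hx with rfl | rfl | rfl <;> rcases hy with rfl | rfl | rfl <;>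
          simp_all [Sym2.eq_swap]
      · simp only [Sym2.eq_iff]
        rintro (h | h | h) <;> rcases h with ⟨rfl, rfl⟩ | ⟨rfl, rfl⟩ <;>
          simp_all [Sym2.eq_swap]
  rw [faceEnergy, hE, Finset.sum_insert, Finset.sum_insert, Finset.sum_singleton]
  · simp only [edgeEnergy_mk]
    ring
  · simp [hab, hac]
  · simp [hac, hbc]

/-- In a triangle with exactly one pair of equal spins, that pair is the only monochromatic edge. -/
lemma exists_unique_monochromatic_edge {V : Type*} {τ : V → ℤ} {f : Finset V} {a b c : V}
    (hf : ∀ x, x ∈ f ↔ x = a ∨ x = b ∨ x = c) (hne : a ≠ b)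
    (hab : τ a = τ b) (hac : τ a ≠ τ c) :
    ∃ u ∈ f, ∃ v ∈ f, u ≠ v ∧ τ u = τ v ∧
      ∀ u' ∈ f, ∀ v' ∈ f, u' ≠ v' → τ u' = τ v' → s(u', v') = s(u, v) := by
  refine ⟨a, by simp [hf], b, by simp [hf], hne, hab, fun u hu v hv huv h => ?_⟩
  have hbc : τ b ≠ τ c := hab ▸ hac
  rw [hf] at hu hv
  rcases hu with rfl | rfl | rfl <;> rcases hv with rfl | rfl | rfl <;>
    first
    | rfl
    | exact Sym2.eq_swap
    | exact absurd rfl huv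
    | exact absurd h ‹_›
    | exact absurd h.symm ‹_›

/-- Let `G = (V, E)` be a finite simple graph and `F` a family of 3-element subsets of `V`,
each spanning a triangle of `G`, such that every edge lies in exactly two faces.  If some
satisfying spin assignment exists, then every groundstate (minimizer of the Hamiltonian) is
satisfying: under every minimizer, each face has exactly one monochromatic edge. -/
theorem groundstate_is_satisfying {V : Type*} [DecidableEq V]
    (E : Finset (Sym2 V)) (F : Finset (Finset V))
    (hsimple : ∀ e ∈ E, ¬ e.IsDiag)
    (hface : ∀ f ∈ F, f.card = 3 ∧ ∀ u ∈ f, ∀ v ∈ f, u ≠ v → s(u, v) ∈ E)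
    (htwo : ∀ e ∈ E, (F.filter (fun f => ∀ v ∈ e, v ∈ f)).card = 2)
    (hex : ∃ σ : V → ℤ, IsSpin σ ∧ ∀ f ∈ F, ¬ FaceMono σ f) :
    ∀ τ : V → ℤ, IsSpin τ →
      (∀ ρ : V → ℤ, IsSpin ρ → Hamiltonian E τ ≤ Hamiltonian E ρ) →
      ∀ f ∈ F, ∃ u ∈ f, ∃ v ∈ f, u ≠ v ∧ τ u = τ v ∧
        ∀ u' ∈ f, ∀ v' ∈ f, u' ≠ v' → τ u' = τ v' → s(u', v') = s(u, v) := by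
  intro τ hτ hmin
  obtain ⟨σ, hσ, hsat⟩ := hex
  have htri : ∀ f ∈ F, ∃ a b c, a ≠ b ∧ a ≠ c ∧ b ≠ c ∧ f = {a, b, c} ∧
      ∀ ρ : V → ℤ, faceEnergy E ρ f = ρ a * ρ b + ρ a * ρ c + ρ b * ρ c := by
    intro f hf
    obtain ⟨hcard, hE⟩ := hface f hf
    obtain ⟨a, b, c, hab, hac, hbc, rfl⟩ := Finset.card_eq_three.1 hcard
    refine ⟨a, b, c, hab, hac, hbc, by ext; simp, fun ρ => ?_⟩
    convert faceEnergy_triangle hsimple ρ hab hac hbc (hE a (by simp) b (by simp) hab)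
      (hE a (by simp) c (by simp) hac) (hE b (by simp) c (by simp) hbc)
  have hσF : ∀ f ∈ F, faceEnergy E σ f = -1 := by
    intro f hf
    have hns := hsat f hf
    obtain ⟨a, b, c, -, -, -, rfl, hw⟩ := htri f hf
    rw [hw]
    rcases hσ a with ha | ha <;> rcases hσ b with hb | hb <;> rcases hσ c with hc | hc <;>
      simp [FaceMono, ha, hb, hc] at hns ⊢
  have hτF : ∀ f ∈ F, -1 ≤ faceEnergy E τ f := by
    intro f hf
    obtain ⟨a, b, c, -, -, -, -, hw⟩ := htri f hf
    rw [hw]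
    rcases hτ a with ha | ha <;> rcases hτ b with hb | hb <;> rcases hτ c with hc | hc <;>
      simp [ha, hb, hc]
  have hle : ∑ f ∈ F, faceEnergy E τ f ≤ ∑ f ∈ F, (-1 : ℤ) := by
    rw [← Finset.sum_congr rfl hσF, sum_faceEnergy E F (by convert htwo),
      sum_faceEnergy E F (by convert htwo)]
    linarith [hmin σ hσ]
  have heq := (Finset.sum_eq_sum_iff_of_le hτF).1 (le_antisymm (Finset.sum_le_sum hτF) hle)
  intro f hf
  have hf1 := heq f hf
  obtain ⟨a, b, c, hab, hac, hbc, rfl, hw⟩ := htri f hf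
  rw [hw] at hf1
  have hpair : τ a = τ b ∧ τ a ≠ τ c ∨ τ a = τ c ∧ τ a ≠ τ b ∨ τ b = τ c ∧ τ b ≠ τ a := by
    rcases hτ a with ha | ha <;> rcases hτ b with hb | hb <;> rcases hτ c with hc | hc <;>
      simp [ha, hb, hc] at hf1 ⊢
  rcases hpair with ⟨h, h'⟩ | ⟨h, h'⟩ | ⟨h, h'⟩
  · exact exists_unique_monochromatic_edge (by simp) hab h h'
  · exact exists_unique_monochromatic_edge (by grind) hac h h'
  · exact exists_unique_monochromatic_edge (by grind) hbc h h'
end
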